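/- Let A ∈ ℂ(ε)^{n×n} be a matrix of rank at most k, and suppose that for every size-k subset S ⊆ [n], the limit lim_{ε→0} A[S] exists, where A[S] = det of the principal submatrix of A with rows and columns indexed by S. Then there exists B ∈ ℂ^{n×n} such that for every size-k subset S ⊆ [n], lim_{ε→0} A[S] = B[S]. -/

import Mathlib

open Polynomial Matrix MvPolynomial
open scoped Classical

/-- The ε-adic valuation on F(ε): `val(g/h) = mindeg g - mindeg h` for nonzero elements
(`mindeg p = rootMultiplicity 0 p`), and `val 0 = +∞`. -/
noncomputable def rfval (f : RatFunc ℂ) : WithTop ℤ :=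
  if f = 0 then ⊤
  else (((f.num.rootMultiplicity 0 : ℤ) - (f.denom.rootMultiplicity 0 : ℤ) : ℤ) : WithTop ℤ)

/-- `lim_{ε→0} f` exists iff `f` has no pole at ε = 0, i.e. val(f) ≥ 0. -/
def rfHasLim (f : RatFunc ℂ) : Prop := 0 ≤ rfval f

/-- The value of `f` at ε = 0 (the limit of `f` at 0, when it exists). -/
noncomputable def rfLim (f : RatFunc ℂ) : ℂ :=
  f.eval (RingHom.id ℂ) 0

/-- The principal submatrix of `A` with rows and columns indexed by a size-`k` subset `S`. -/
def prinSub {α : Type*} {n k : ℕ} (A : Matrix (Fin n) (Fin n) α)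
    (S : {S : Finset (Fin n) // S.card = k}) : Matrix (Fin k) (Fin k) α :=
  A.submatrix (fun i : Fin k => (S.1.orderIsoOfFin S.2 i : Fin n))
    (fun j : Fin k => (S.1.orderIsoOfFin S.2 j : Fin n))

/-- Abstract matroid-like rank function on finsets. -/
structure RankLike {α : Type*} [DecidableEq α] (r : Finset α → ℕ) : Prop where
  empty : r ∅ = 0
  mono : ∀ X Y, X ⊆ Y → r X ≤ r Y
  insert_le : ∀ e X, r (insert e X) ≤ r X + 1
  submod : ∀ X Y, r (X ∪ Y) + r (X ∩ Y) ≤ r X + r Y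

/-- Submodularity, in a flexible form. -/
theorem RankLike.submod' {α : Type*} [DecidableEq α] {r : Finset α → ℕ} (h : RankLike r)
    (X Y Z W : Finset α) (hZ : Z ⊆ X ∪ Y) (hW : W ⊆ X ∩ Y) : r Z + r W ≤ r X + r Y :=
  le_trans (Nat.add_le_add (h.mono _ _ hZ) (h.mono _ _ hW)) (h.submod X Y)

/-- Matroid intersection, with a contracted common independent set `C`. -/
theorem matroid_inter_aux {α : Type*} [DecidableEq α] {r1 r2 : Finset α → ℕ}
    (h1 : RankLike r1) (h2 : RankLike r2) (k : ℕ) (E : Finset α) :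
    ∀ C : Finset α, r1 C = C.card → r2 C = C.card → Disjoint E C →
      (∀ X, X ⊆ E → k + C.card ≤ r1 (X ∪ C) + r2 ((E \ X) ∪ C)) →
      ∃ I : Finset α, k ≤ I.card ∧ r1 I = I.card ∧ r2 I = I.card := by
  induction E using Finset.induction_on with
  | empty =>
    intro C hC1 hC2 _ h
    refine ⟨C, ?_, hC1, hC2⟩
    have := h ∅ (by simp)
    simp only [Finset.empty_sdiff, Finset.empty_union, hC1, hC2] at this
    omega
  | insert e E he ih =>
    intro C hC1 hC2 hd h
    have heC : e ∉ C := fun hc =>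
      (Finset.disjoint_left.mp hd) (Finset.mem_insert_self e E) hc
    have hdE : Disjoint E C := Finset.disjoint_of_subset_left (Finset.subset_insert e E) hd
    by_cases hdel : ∀ X, X ⊆ E → k + C.card ≤ r1 (X ∪ C) + r2 ((E \ X) ∪ C)
    · exact ih C hC1 hC2 hdE hdel
    push Not at hdel
    obtain ⟨X, hX, hXlt⟩ := hdel
    have hcard : (insert e C).card = C.card + 1 := Finset.card_insert_of_notMem heC
    have hi1 : r1 (insert e C) = (insert e C).card := by
      by_contra hne
      have hle := h1.insert_le e C
      have hs := h1.submod' (X ∪ C) (insert e C) (insert e X ∪ C) C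
        (by grind) (by grind)
      have hc := h (insert e X) (by grind)
      have : (insert e E \ insert e X) ∪ C = (E \ X) ∪ C := by
        clear * - he hX
        ext z
        by_cases hz : z = e
        · subst hz; simp [he]
        · simp [hz]
      rw [this] at hc
      omega
    have hi2 : r2 (insert e C) = (insert e C).card := by
      by_contra hne
      have hle := h2.insert_le e C
      have hs := h2.submod' ((E \ X) ∪ C) (insert e C) ((insert e E \ X) ∪ C) C
        (by grind) (by grind)
      have hc := h X (by grind)
      omega
    by_cases hcon : ∀ Y, Y ⊆ E →
        k + (insert e C).card ≤ r1 (Y ∪ insert e C) + r2 ((E \ Y) ∪ insert e C)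
    · exact ih (insert e C) hi1 hi2 (by
        rw [Finset.disjoint_insert_right]; exact ⟨he, hdE⟩) hcon
    push Not at hcon
    obtain ⟨Y, hY, hYlt⟩ := hcon
    have a1 := h (insert e (X ∪ Y)) (by grind)
    have a2 := h (X ∩ Y) (by grind)
    have s1 := h1.submod' (X ∪ C) (Y ∪ insert e C) (insert e (X ∪ Y) ∪ C) ((X ∩ Y) ∪ C)
      (by grind) (by grind)
    have s2 := h2.submod' ((E \ X) ∪ C) ((E \ Y) ∪ insert e C)
      ((insert e E \ (X ∩ Y)) ∪ C) ((insert e E \ insert e (X ∪ Y)) ∪ C)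
      (by intro z; simp; tauto) (by intro z; simp; tauto)
    omega

/-- Rank function of a vector configuration. -/
noncomputable def vrank {k n : ℕ} (u : Fin n → Fin k → ℂ) (X : Finset (Fin n)) : ℕ :=
  Module.finrank ℂ (Submodule.span ℂ (u '' (X : Set (Fin n))))

theorem vrank_rankLike {k n : ℕ} (u : Fin n → Fin k → ℂ) : RankLike (vrank u) where
  empty := by simp [vrank]
  mono X Y h := Submodule.finrank_mono (Submodule.span_mono (Set.image_mono (by exact_mod_cast h)))
  insert_le e X := by
    unfold vrank
    rw [Finset.coe_insert, Set.image_insert_eq, Set.insert_eq, Submodule.span_union]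
    have := Submodule.finrank_add_le_finrank_add_finrank (Submodule.span ℂ {u e})
      (Submodule.span ℂ (u '' (X : Set (Fin n))))
    have h2 := finrank_span_le_card (R := ℂ) ({u e} : Set (Fin k → ℂ))
    simp only [Set.toFinset_singleton, Finset.card_singleton] at h2
    omega
  submod X Y := by
    unfold vrank
    rw [Finset.coe_union, Set.image_union, Submodule.span_union,
      ← Submodule.finrank_sup_add_finrank_inf_eq (Submodule.span ℂ (u '' (X : Set (Fin n))))
        (Submodule.span ℂ (u '' (Y : Set (Fin n))))]
    apply Nat.add_le_add_left
    apply Submodule.finrank_mono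
    apply le_inf <;>
    · refine Submodule.span_mono (Set.image_mono ?_)
      simp

/-- The increasing enumeration of `S`. -/
def semb {n k : ℕ} (S : {S : Finset (Fin n) // S.card = k}) : Fin k → Fin n :=
  fun i => (S.1.orderIsoOfFin S.2 i : Fin n)

/-- Square column submatrix. -/
def csub {α : Type*} {n k : ℕ} (U : Matrix (Fin k) (Fin n) α)
    (S : {S : Finset (Fin n) // S.card = k}) : Matrix (Fin k) (Fin k) α :=
  U.submatrix id (semb S)

theorem det_csub_ne_zero {n k : ℕ} (U : Matrix (Fin k) (Fin n) ℂ)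
    (S : {S : Finset (Fin n) // S.card = k}) (h : vrank Uᵀ S.1 = k) : (csub U S).det ≠ 0 := by
  have hr : Set.range (fun i => Uᵀ (semb S i)) = Uᵀ '' (S.1 : Set (Fin n)) := by
    ext x
    constructor
    · rintro ⟨i, rfl⟩
      exact ⟨semb S i, (S.1.orderIsoOfFin S.2 i).2, rfl⟩
    · rintro ⟨j, hj, rfl⟩
      exact ⟨(S.1.orderIsoOfFin S.2).symm ⟨j, hj⟩, by simp [semb]⟩
  have hli : LinearIndependent ℂ (fun i => Uᵀ (semb S i)) := by
    rw [linearIndependent_iff_card_eq_finrank_span, Set.finrank, hr]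
    simpa [vrank] using h.symm
  have : LinearIndependent ℂ (csub U S).col := hli
  rw [Matrix.linearIndependent_cols_iff_isUnit, Matrix.isUnit_iff_isUnit_det] at this
  exact this.ne_zero

theorem exists_rank_lt {n k : ℕ} (U V : Matrix (Fin k) (Fin n) ℂ)
    (h : ∀ S : {S : Finset (Fin n) // S.card = k}, (csub U S).det * (csub V S).det = 0) :
    ∃ X : Finset (Fin n), vrank Uᵀ X + vrank Vᵀ Xᶜ < k := by
  by_contra! hc
  obtain ⟨I, hk, hI1, hI2⟩ := matroid_inter_aux (vrank_rankLike Uᵀ) (vrank_rankLike Vᵀ) k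
    Finset.univ ∅ (by simp [(vrank_rankLike Uᵀ).empty]) (by simp [(vrank_rankLike Vᵀ).empty])
    (by simp) (fun X _ => by simpa [Finset.compl_eq_univ_sdiff] using hc X)
  have hle : I.card ≤ k := by
    rw [← hI1]
    simpa [vrank] using Submodule.finrank_le (Submodule.span ℂ (Uᵀ '' (I : Set (Fin n))))
  have hIk : I.card = k := le_antisymm hle hk
  exact mul_ne_zero (det_csub_ne_zero U ⟨I, hIk⟩ (hI1.trans hIk))
    (det_csub_ne_zero V ⟨I, hIk⟩ (hI2.trans hIk)) (h ⟨I, hIk⟩)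

theorem exists_row_reduce {n k : ℕ} (U : Matrix (Fin k) (Fin n) ℂ) (X : Finset (Fin n)) :
    ∃ (P : Matrix (Fin k) (Fin k) ℂ) (J : Finset (Fin k)), P.det ≠ 0 ∧
      J.card + vrank Uᵀ X = k ∧ ∀ i ∈ J, ∀ x ∈ X, (P * U) i x = 0 := by
  set W := Submodule.span ℂ (Uᵀ '' (X : Set (Fin n))) with hW
  obtain ⟨W', hc⟩ := Submodule.exists_isCompl W
  have hsum := Submodule.finrank_add_eq_of_isCompl hc
  rw [Module.finrank_fin_fun] at hsum
  let b0 := ((Module.finBasis ℂ W).prod (Module.finBasis ℂ W')).map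
    (Submodule.prodEquivOfIsCompl W W' hc)
  let σ : (Fin (Module.finrank ℂ W) ⊕ Fin (Module.finrank ℂ W')) ≃ Fin k :=
    finSumFinEquiv.trans (finCongr hsum)
  let b := b0.reindex σ
  refine ⟨LinearMap.toMatrix' b.equivFun.toLinearMap,
    Finset.univ.map (Function.Embedding.inr.trans σ.toEmbedding), ?_, ?_, ?_⟩
  · rw [LinearMap.det_toMatrix']
    exact (LinearEquiv.isUnit_det' b.equivFun).ne_zero
  · simp only [Finset.card_map, Finset.card_univ, Fintype.card_fin]
    change Module.finrank ℂ W' + Module.finrank ℂ W = k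
    omega
  · intro i hi x hx
    simp only [Finset.mem_map, Finset.mem_univ, true_and] at hi
    obtain ⟨j, rfl⟩ := hi
    have hmem : Uᵀ x ∈ W := Submodule.subset_span ⟨x, by exact_mod_cast hx, rfl⟩
    have : (LinearMap.toMatrix' b.equivFun.toLinearMap * U) (σ (Sum.inr j)) x
        = b.equivFun (Uᵀ x) (σ (Sum.inr j)) := by
      have h := LinearMap.toMatrix'_mulVec b.equivFun.toLinearMap (Uᵀ x)
      exact congrFun h (σ (Sum.inr j))
    change (LinearMap.toMatrix' b.equivFun.toLinearMap * U) (σ (Sum.inr j)) x = 0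
    rw [this]
    have h3 : (Submodule.prodEquivOfIsCompl W W' hc).symm (Uᵀ x) = (⟨Uᵀ x, hmem⟩, 0) :=
      Submodule.prodEquivOfIsCompl_symm_apply_left W W' hc ⟨Uᵀ x, hmem⟩
    simp [b, b0, h3]

theorem csub_mul {α : Type*} [CommRing α] {n k : ℕ} (M : Matrix (Fin k) (Fin k) α)
    (U : Matrix (Fin k) (Fin n) α) (S : {S : Finset (Fin n) // S.card = k}) :
    csub (M * U) S = M * csub U S := rfl

theorem csub_mul_diagonal {α : Type*} [CommRing α] {n k : ℕ}
    (U : Matrix (Fin k) (Fin n) α) (d : Fin n → α) (S : {S : Finset (Fin n) // S.card = k}) :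
    csub (U * Matrix.diagonal d) S = csub U S * Matrix.diagonal (fun i => d (semb S i)) := by
  ext i j
  simp [csub]

/-- reduction at `ε = 0` -/
noncomputable def red {n k : ℕ} (U : Matrix (Fin k) (Fin n) ℂ[X]) : Matrix (Fin k) (Fin n) ℂ :=
  U.map (Polynomial.evalRingHom 0)

theorem det_csub_red {n k : ℕ} (U : Matrix (Fin k) (Fin n) ℂ[X])
    (S : {S : Finset (Fin n) // S.card = k}) :
    (csub (red U) S).det = (csub U S).det.eval 0 := by
  have := RingHom.map_det (Polynomial.evalRingHom (0 : ℂ)) (csub U S)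
  exact this.symm

theorem half_step {n k : ℕ} (U : Matrix (Fin k) (Fin n) ℂ[X]) (T : Finset (Fin n)) :
    ∃ (U' : Matrix (Fin k) (Fin n) ℂ[X]) (j : ℕ) (c : ℂ), c ≠ 0 ∧ j + vrank (red U)ᵀ T = k ∧
      ∀ S : {S : Finset (Fin n) // S.card = k},
        Polynomial.X ^ j * (csub U' S).det = Polynomial.C c * (csub U S).det *
          ∏ i, (if semb S i ∈ T then 1 else Polynomial.X) := by
  obtain ⟨P, J, hP, hJ, hz⟩ := exists_row_reduce (red U) T
  let M : Matrix (Fin k) (Fin n) ℂ[X] :=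
    (P.map Polynomial.C * U) *
      (Matrix.diagonal (fun x => if x ∈ T then 1 else Polynomial.X) : Matrix (Fin n) (Fin n) ℂ[X])
  have hdvd : ∀ i x, (if i ∈ J then (Polynomial.X : ℂ[X]) else 1) ∣ M i x := by
    intro i x
    split_ifs with hi
    · simp only [M, Matrix.mul_diagonal]
      split_ifs with hx
      · rw [mul_one, Polynomial.X_dvd_iff, Polynomial.coeff_zero_eq_eval_zero]
        refine Eq.trans ?_ (hz i hi x hx)
        simp [Matrix.mul_apply, red, Polynomial.eval_finsetSum]
      · exact Dvd.intro_left _ rfl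
    · exact one_dvd _
  choose U' hU' using hdvd
  refine ⟨Matrix.of U', J.card, P.det, hP, hJ, fun S => ?_⟩
  have hM : Matrix.diagonal (fun i => if i ∈ J then (Polynomial.X : ℂ[X]) else 1) * Matrix.of U'
      = M := by
    ext1 i x
    simp only [Matrix.diagonal_mul, Matrix.of_apply]
    exact (hU' i x).symm
  have hd := congrArg (fun N => (csub N S).det) hM
  simp only [M, csub_mul, csub_mul_diagonal, Matrix.det_mul, Matrix.det_diagonal] at hd
  have hPd : (P.map Polynomial.C).det = Polynomial.C P.det :=
    (RingHom.map_det (Polynomial.C) P).symm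
  rw [hPd] at hd
  rw [← hd, Finset.prod_ite]
  simp

theorem full_step {n k : ℕ} (U V : Matrix (Fin k) (Fin n) ℂ[X])
    (h : ∀ S : {S : Finset (Fin n) // S.card = k},
      Polynomial.X ∣ (csub U S).det * (csub V S).det) :
    ∃ U' V' : Matrix (Fin k) (Fin n) ℂ[X], ∀ S : {S : Finset (Fin n) // S.card = k},
      (csub U S).det * (csub V S).det = Polynomial.X * ((csub U' S).det * (csub V' S).det) := by
  obtain ⟨T, hT⟩ := exists_rank_lt (red U) (red V) (fun S => by
    rw [det_csub_red, det_csub_red, ← Polynomial.eval_mul]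
    have := h S
    rwa [Polynomial.X_dvd_iff, Polynomial.coeff_zero_eq_eval_zero] at this)
  obtain ⟨U', j1, c1, hc1, hj1, hU'⟩ := half_step U T
  obtain ⟨V', j2, c2, hc2, hj2, hV'⟩ := half_step V Tᶜ
  obtain ⟨t, ht⟩ : ∃ t, j1 + j2 = k + (t + 1) := ⟨j1 + j2 - k - 1, by omega⟩
  have hk : 0 < k := by omega
  let a : ℂ[X] := Polynomial.C (c1 * c2)⁻¹ * Polynomial.X ^ t
  let D : Matrix (Fin k) (Fin k) ℂ[X] := Matrix.diagonal (fun i => if i = ⟨0, hk⟩ then a else 1)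
  refine ⟨D * U', V', fun S => ?_⟩
  rw [csub_mul, Matrix.det_mul, Matrix.det_diagonal, Finset.prod_ite_eq' Finset.univ]
  simp only [Finset.mem_univ, if_true]
  have e1 := hU' S
  have e2 := hV' S
  have hp : (∏ i, (if semb S i ∈ T then (1 : ℂ[X]) else Polynomial.X)) *
      (∏ i, (if semb S i ∈ Tᶜ then (1 : ℂ[X]) else Polynomial.X)) = Polynomial.X ^ k := by
    rw [← Finset.prod_mul_distrib]
    rw [Finset.prod_congr rfl (g := fun _ => (Polynomial.X : ℂ[X]))]
    · simp
    · intro i _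
      by_cases hi : semb S i ∈ T <;> simp [hi]
  have e3 : Polynomial.X ^ k * (Polynomial.X ^ (t + 1) * ((csub U' S).det * (csub V' S).det)) =
      Polynomial.X ^ k *
        (Polynomial.C c1 * Polynomial.C c2 * ((csub U S).det * (csub V S).det)) := by
    calc _ = (Polynomial.X ^ (j1 + j2)) * ((csub U' S).det * (csub V' S).det) := by
            rw [ht, pow_add]; ring
      _ = (Polynomial.X ^ j1 * (csub U' S).det) * (Polynomial.X ^ j2 * (csub V' S).det) := by
            ring
      _ = _ := by rw [e1, e2, ← hp]; ring
  have e4 := mul_left_cancel₀ (pow_ne_zero k Polynomial.X_ne_zero) e3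
  have hc : Polynomial.C (c1 * c2)⁻¹ * (Polynomial.C c1 * Polynomial.C c2) = 1 := by
    rw [← Polynomial.C_mul, ← Polynomial.C_mul, inv_mul_cancel₀ (mul_ne_zero hc1 hc2),
      Polynomial.C_1]
  calc (csub U S).det * (csub V S).det
      = Polynomial.C (c1 * c2)⁻¹ * (Polynomial.C c1 * Polynomial.C c2) *
          ((csub U S).det * (csub V S).det) := by rw [hc, one_mul]
    _ = Polynomial.C (c1 * c2)⁻¹ *
        (Polynomial.X ^ (t + 1) * ((csub U' S).det * (csub V' S).det)) := by rw [e4]; ring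
    _ = _ := by simp only [a]; ring

theorem iter_step {n k : ℕ} (m : ℕ) : ∀ (U V : Matrix (Fin k) (Fin n) ℂ[X]),
    (∀ S : {S : Finset (Fin n) // S.card = k},
      Polynomial.X ^ m ∣ (csub U S).det * (csub V S).det) →
    ∃ U' V' : Matrix (Fin k) (Fin n) ℂ[X], ∀ S : {S : Finset (Fin n) // S.card = k},
      (csub U S).det * (csub V S).det =
        Polynomial.X ^ m * ((csub U' S).det * (csub V' S).det) := by
  induction m with
  | zero => intro U V _; exact ⟨U, V, fun S => by simp⟩
  | succ m ih =>
    intro U V h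
    obtain ⟨U1, V1, h1⟩ := full_step U V (fun S => (dvd_pow_self _ (by simp)).trans (h S))
    obtain ⟨U2, V2, h2⟩ := ih U1 V1 (fun S => by
      have := h S
      rw [h1 S, pow_succ'] at this
      exact (mul_dvd_mul_iff_left Polynomial.X_ne_zero).mp this)
    exact ⟨U2, V2, fun S => by rw [h1, h2, pow_succ']; ring⟩

theorem prinSub_mul_det {α : Type*} [CommRing α] {n k : ℕ} (U V : Matrix (Fin k) (Fin n) α)
    (S : {S : Finset (Fin n) // S.card = k}) :
    (prinSub (Uᵀ * V) S).det = (csub U S).det * (csub V S).det := by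
  have : prinSub (Uᵀ * V) S = (csub U S)ᵀ * csub V S := rfl
  rw [this, Matrix.det_mul, Matrix.det_transpose]

theorem exists_factor {K : Type*} [Field K] {n k : ℕ} (A : Matrix (Fin n) (Fin n) K)
    (h : A.rank ≤ k) : ∃ U V : Matrix (Fin k) (Fin n) K, A = Uᵀ * V := by
  have hr : Module.finrank K (LinearMap.range A.mulVecLin) ≤ k := h
  let W := LinearMap.range A.mulVecLin
  let b := Module.finBasis K W
  let ι : Fin (Module.finrank K W) → Fin k := Fin.castLE hr
  have hmem : ∀ j, A.col j ∈ W := fun j => ⟨Pi.single j 1, by simp⟩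
  let U : Matrix (Fin k) (Fin n) K := Matrix.of fun i x =>
    if hi : (i : ℕ) < Module.finrank K W then (b ⟨i, hi⟩ : Fin n → K) x else 0
  let V : Matrix (Fin k) (Fin n) K := Matrix.of fun i y =>
    if hi : (i : ℕ) < Module.finrank K W then b.repr ⟨A.col y, hmem y⟩ ⟨i, hi⟩ else 0
  refine ⟨U, V, ?_⟩
  ext x y
  have h1 := congrArg (fun w : W => (w : Fin n → K) x) (b.sum_repr ⟨A.col y, hmem y⟩)
  simp only [Submodule.coe_sum, Submodule.coe_smul, Finset.sum_apply, Pi.smul_apply,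
    smul_eq_mul] at h1
  have h2 : A x y = A.col y x := rfl
  rw [h2, ← h1, Matrix.mul_apply]
  symm
  refine (Finset.sum_of_injOn ι (Fin.castLE_injective hr).injOn (by simp) ?_ ?_).symm
  · intro i _ hi
    have : ¬ (i : ℕ) < Module.finrank K W := fun hlt => hi ⟨⟨i, hlt⟩, by simp, rfl⟩
    simp [U, Matrix.transpose_apply, this]
  · intro i _
    simp [U, V, Matrix.transpose_apply, ι, mul_comm]

theorem exists_clear {n k : ℕ} (U : Matrix (Fin k) (Fin n) (RatFunc ℂ)) :
    ∃ (d : ℂ[X]) (U' : Matrix (Fin k) (Fin n) ℂ[X]), d ≠ 0 ∧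
      ∀ S : {S : Finset (Fin n) // S.card = k},
        algebraMap ℂ[X] (RatFunc ℂ) d * (csub U S).det =
          algebraMap ℂ[X] (RatFunc ℂ) (csub U' S).det := by
  obtain ⟨d, hd⟩ := IsLocalization.exist_integer_multiples_of_finite
    (nonZeroDivisors ℂ[X]) (fun p : Fin k × Fin n => U p.1 p.2)
  choose U' hU' using hd
  refine ⟨(d : ℂ[X]) ^ k, fun i j => U' (i, j), pow_ne_zero _ (nonZeroDivisors.ne_zero d.2),
    fun S => ?_⟩
  rw [RingHom.map_det]
  have : (algebraMap ℂ[X] (RatFunc ℂ)).mapMatrix (csub (fun i j => U' (i, j)) S)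
      = (algebraMap ℂ[X] (RatFunc ℂ) d) • csub U S := by
    ext i j
    have := hU' (i, semb S j)
    simp only [Algebra.smul_def] at this
    exact this
  rw [this, Matrix.det_smul, Fintype.card_fin, map_pow]

theorem denom_eval_ne_zero {f : RatFunc ℂ} (h : rfHasLim f) : f.denom.eval 0 ≠ 0 := by
  intro h0
  by_cases hf : f = 0
  · subst hf; simp at h0
  have hd : 0 < f.denom.rootMultiplicity 0 :=
    (Polynomial.rootMultiplicity_pos f.denom_ne_zero).mpr h0
  have hn : f.num.rootMultiplicity 0 = 0 := by
    by_contra hne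
    have hr : f.num.eval 0 = 0 :=
      (Polynomial.rootMultiplicity_pos (RatFunc.num_ne_zero hf)).mp (Nat.pos_of_ne_zero hne)
    obtain ⟨a, b, hab⟩ := f.isCoprime_num_denom
    have := congrArg (Polynomial.eval 0) hab
    simp [hr, h0] at this
  unfold rfHasLim rfval at h
  rw [if_neg hf] at h
  have : (0 : ℤ) ≤ (f.num.rootMultiplicity 0 : ℤ) - (f.denom.rootMultiplicity 0 : ℤ) := by
    exact_mod_cast h
  omega

/-- If A ∈ ℂ(ε)^{n×n} has rank at most k and every size-k principal minor of A has a limit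
as ε → 0, then there is B ∈ ℂ^{n×n} whose size-k principal minors are those limits. -/
theorem principal_minor_limits_realizable {n k : ℕ}
    (A : Matrix (Fin n) (Fin n) (RatFunc ℂ)) (hrk : A.rank ≤ k)
    (hlim : ∀ S : {S : Finset (Fin n) // S.card = k}, rfHasLim (prinSub A S).det) :
    ∃ B : Matrix (Fin n) (Fin n) ℂ,
      ∀ S : {S : Finset (Fin n) // S.card = k},
        rfLim (prinSub A S).det = (prinSub B S).det := by
  rcases Nat.eq_zero_or_pos k with hk0 | hk
  · subst hk0
    refine ⟨0, fun S => ?_⟩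
    simp [rfLim]
  obtain ⟨P, Q, hPQ⟩ := exists_factor A hrk
  obtain ⟨d1, U, hd1, hU⟩ := exists_clear P
  obtain ⟨d2, V, hd2, hV⟩ := exists_clear Q
  obtain ⟨e, he, hnd⟩ := Polynomial.exists_eq_pow_rootMultiplicity_mul_and_not_dvd
    (d1 * d2) (mul_ne_zero hd1 hd2) 0
  set m := (d1 * d2).rootMultiplicity 0
  rw [Polynomial.C_0, sub_zero] at he hnd
  have he0 : e.eval 0 ≠ 0 := by
    rwa [Polynomial.X_dvd_iff, Polynomial.coeff_zero_eq_eval_zero] at hnd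
  have key : ∀ S : {S : Finset (Fin n) // S.card = k},
      Polynomial.X ^ m * (e * (prinSub A S).det.num) =
        (prinSub A S).det.denom * ((csub U S).det * (csub V S).det) := by
    intro S
    apply RatFunc.algebraMap_injective ℂ
    have hA : (prinSub A S).det = (csub P S).det * (csub Q S).det := by
      rw [hPQ, prinSub_mul_det]
    have hnum := RatFunc.num_div_denom (prinSub A S).det
    have hden : algebraMap ℂ[X] (RatFunc ℂ) (prinSub A S).det.denom ≠ 0 :=
      RatFunc.algebraMap_ne_zero (RatFunc.denom_ne_zero _)
    rw [div_eq_iff hden] at hnum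
    rw [← mul_assoc, ← he]
    simp only [map_mul]
    rw [← hU S, ← hV S, hnum]
    rw [hA]
    ring
  obtain ⟨U', V', h'⟩ := iter_step m U V (fun S => by
    have hcop : IsCoprime (Polynomial.X ^ m) (prinSub A S).det.denom := by
      apply IsCoprime.pow_left
      rw [Polynomial.irreducible_X.coprime_iff_not_dvd, Polynomial.X_dvd_iff,
        Polynomial.coeff_zero_eq_eval_zero]
      exact denom_eval_ne_zero (hlim S)
    exact hcop.dvd_of_dvd_mul_left (Dvd.intro _ (key S)))
  let M : Matrix (Fin k) (Fin k) ℂ :=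
    Matrix.diagonal (fun i => if i = ⟨0, hk⟩ then (e.eval 0)⁻¹ else 1)
  refine ⟨(M * red U')ᵀ * red V', fun S => ?_⟩
  rw [prinSub_mul_det, csub_mul, Matrix.det_mul, det_csub_red, det_csub_red,
    Matrix.det_diagonal, Finset.prod_ite_eq' Finset.univ]
  simp only [Finset.mem_univ, if_true]
  have h1 := key S
  rw [h' S] at h1
  have h2 : e * (prinSub A S).det.num =
      (prinSub A S).det.denom * ((csub U' S).det * (csub V' S).det) := by
    apply mul_left_cancel₀ (pow_ne_zero m (Polynomial.X_ne_zero (R := ℂ)))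
    rw [h1]; ring
  have h3 := congrArg (Polynomial.eval 0) h2
  simp only [Polynomial.eval_mul] at h3
  have hd0 := denom_eval_ne_zero (hlim S)
  unfold rfLim RatFunc.eval
  simp only [Polynomial.eval₂_id]
  field_simp
  linear_combination h3
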